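/- arXiv:1712.10140 — 3 statements merged into one kernel-verified Lean document; each statement's English description precedes it below -/
import Mathlib

section
/- Let H be a complex Hilbert space and let {A,B} be a dual pair of densely defined closed linear operators on H. Then n(A*,B) = n(B*,A), i.e. the dimension of the quotient vector space dom A*/dom B equals the dimension of the quotient vector space dom B*/dom A. -/
noncomputable section

/-- The eigenspace `{x ∈ dom T : T x = l • x}` of a partially defined linear operator `T`;
for `T = S.adjoint` and `l = λ` this is the defect subspace `N_λ(S) = ker(S* - λ)`. -/
def LinearPMap.eigSpace {F : Type*} [AddCommGroup F] [Module ℂ F]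
    (T : F →ₗ.[ℂ] F) (l : ℂ) : Submodule ℂ F where
  carrier := {x | ∃ hx : x ∈ T.domain, T ⟨x, hx⟩ = l • x}
  zero_mem' := ⟨T.domain.zero_mem, by
    have : (⟨(0 : F), T.domain.zero_mem⟩ : T.domain) = 0 := rfl
    rw [this, T.map_zero, smul_zero]⟩
  add_mem' := by
    rintro x y ⟨hx, ex⟩ ⟨hy, ey⟩
    refine ⟨T.domain.add_mem hx hy, ?_⟩
    have : (⟨x + y, T.domain.add_mem hx hy⟩ : T.domain) = ⟨x, hx⟩ + ⟨y, hy⟩ := rfl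
    rw [this, T.map_add, ex, ey, smul_add]
  smul_mem' := by
    rintro c x ⟨hx, ex⟩
    refine ⟨T.domain.smul_mem c hx, ?_⟩
    have : (⟨c • x, T.domain.smul_mem c hx⟩ : T.domain) = c • ⟨x, hx⟩ := rfl
    rw [this, T.map_smul, ex, smul_comm]

/-- The (cardinal) codimension `dim (V / U)` of a submodule `U` inside a submodule `V`. -/
def scodim {F : Type*} [AddCommGroup F] [Module ℂ F] (U V : Submodule ℂ F) : Cardinal :=
  Module.rank ℂ (↥V ⧸ U.comap V.subtype)

variable {H : Type*} [NormedAddCommGroup H] [InnerProductSpace ℂ H] [CompleteSpace H]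

namespace LinearPMap

/-- A vector `(y, w)` with `⟪w, x⟫ = ⟪y, T x⟫` for all `x ∈ dom T` lies in the graph of `T†`. -/
lemma mem_adjoint_graph_of_inner {T : H →ₗ.[ℂ] H} (hT : Dense (T.domain : Set H)) {y w : H}
    (h : ∀ x : T.domain, inner ℂ w (x : H) = inner ℂ y (T x)) : (y, w) ∈ T.adjoint.graph := by
  have hy := mem_adjoint_domain_of_exists y ⟨w, h⟩
  exact T.adjoint.mem_graph_iff.2 ⟨⟨y, hy⟩, rfl, adjoint_apply_eq hT ⟨y, hy⟩ h⟩

/-- The space `ker (B† A† + 1)`, as a subspace of `dom A†`. -/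
def kerAdjointMulAdjointAddOne (A B : H →ₗ.[ℂ] H) : Submodule ℂ A.adjoint.domain :=
  B.adjoint.graph.comap (A.adjoint.toFun.prod (-A.adjoint.domain.subtype))

lemma mem_kerAdjointMulAdjointAddOne {A B : H →ₗ.[ℂ] H} {x : A.adjoint.domain} :
    x ∈ kerAdjointMulAdjointAddOne A B ↔ (A.adjoint x, -(x : H)) ∈ B.adjoint.graph :=
  Iff.rfl

lemma disjoint_kerAdjointMulAdjointAddOne {A B : H →ₗ.[ℂ] H} (hB : Dense (B.domain : Set H))
    (hBA : B ≤ A.adjoint) :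
    Disjoint (B.domain.comap A.adjoint.domain.subtype) (kerAdjointMulAdjointAddOne A B) := by
  rw [Submodule.disjoint_def]
  intro x hxB hx
  obtain ⟨z, hz, hzx⟩ := B.adjoint.mem_graph_iff.1 (mem_kerAdjointMulAdjointAddOne.1 hx)
  have key := adjoint_isFormalAdjoint hB z ⟨x, hxB⟩
  have hBx : B ⟨x, hxB⟩ = A.adjoint x := hBA.2 rfl
  simp only at hz hzx
  rw [hzx, hBx, hz, inner_neg_left, inner_self_eq_norm_sq_to_K, inner_self_eq_norm_sq_to_K] at key
  have key' : -‖(x : H)‖ ^ 2 = ‖A.adjoint x‖ ^ 2 := by exact_mod_cast key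
  have : ‖(x : H)‖ = 0 := by nlinarith [sq_nonneg ‖(x : H)‖, sq_nonneg ‖A.adjoint x‖]
  exact Subtype.ext (norm_eq_zero.1 this)

lemma codisjoint_kerAdjointMulAdjointAddOne {A B : H →ₗ.[ℂ] H} (hB : Dense (B.domain : Set H))
    (hBcl : B.IsClosed) (hBA : B ≤ A.adjoint) :
    Codisjoint (B.domain.comap A.adjoint.domain.subtype) (kerAdjointMulAdjointAddOne A B) := by
  rw [codisjoint_iff, Submodule.eq_top_iff']
  intro x
  let G : Submodule ℂ (WithLp 2 (H × H)) :=
    B.graph.comap (WithLp.linearEquiv 2 ℂ (H × H)).toLinearMap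
  have hG : _root_.IsClosed (G : Set (WithLp 2 (H × H))) :=
    _root_.IsClosed.preimage (WithLp.prod_continuous_ofLp 2 H H) hBcl
  have : CompleteSpace G := hG.completeSpace_coe
  obtain ⟨p, hp, q, hq, hpq⟩ := G.exists_add_mem_mem_orthogonal
    (WithLp.toLp 2 ((x : H), A.adjoint x))
  obtain ⟨u, hu, hBu⟩ := B.mem_graph_iff.1 (show p.ofLp ∈ B.graph from hp)
  have huA : (u : H) ∈ A.adjoint.domain := hBA.1 u.2
  have hAu : A.adjoint ⟨u, huA⟩ = B u := (hBA.2 rfl).symm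
  have hq₁ : q.ofLp.1 = x - u := by
    have := congrArg (fun z => z.ofLp.1) hpq
    simp only [WithLp.ofLp_add, Prod.fst_add] at this
    rw [this, hu, add_sub_cancel_left]
  have hq₂ : q.ofLp.2 = A.adjoint x - B u := by
    have := congrArg (fun z => z.ofLp.2) hpq
    simp only [WithLp.ofLp_add, Prod.snd_add] at this
    rw [this, hBu, add_sub_cancel_left]
  refine Submodule.mem_sup.2
    ⟨⟨u, huA⟩, u.2, x - ⟨u, huA⟩, ?_, add_sub_cancel _ _⟩
  refine mem_adjoint_graph_of_inner hB fun v => ?_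
  have hv : WithLp.toLp 2 ((v : H), B v) ∈ G := B.mem_graph v
  have horth := (Submodule.mem_orthogonal' _ _).1 hq _ hv
  simp only [WithLp.prod_inner_apply, hq₁, hq₂] at horth
  simp only [LinearMap.neg_apply, Submodule.subtype_apply, inner_neg_left, toFun_eq_coe,
    LinearPMap.map_sub, hAu, Submodule.coe_sub]
  linear_combination -horth

/-- `A†` maps `ker (B† A† + 1)` injectively into `ker (A† B† + 1)`. -/
lemma rank_kerAdjointMulAdjointAddOne_le (A B : H →ₗ.[ℂ] H) :
    Module.rank ℂ (kerAdjointMulAdjointAddOne A B) ≤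
      Module.rank ℂ (kerAdjointMulAdjointAddOne B A) := by
  have hdom (x : kerAdjointMulAdjointAddOne A B) : A.adjoint x.1 ∈ B.adjoint.domain :=
    mem_domain_of_mem_graph (mem_kerAdjointMulAdjointAddOne.1 x.2)
  have hval (x : kerAdjointMulAdjointAddOne A B) :
      B.adjoint ⟨A.adjoint x.1, hdom x⟩ = -(x.1 : H) :=
    ((image_iff (hdom x)).2 (mem_kerAdjointMulAdjointAddOne.1 x.2)).symm
  let f : kerAdjointMulAdjointAddOne A B →ₗ[ℂ] B.adjoint.domain :=
    (A.adjoint.toFun ∘ₗ (kerAdjointMulAdjointAddOne A B).subtype).codRestrict _ hdom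
  have hf (x) : f x ∈ kerAdjointMulAdjointAddOne B A := by
    rw [mem_kerAdjointMulAdjointAddOne, show B.adjoint (f x) = _ from hval x]
    exact A.adjoint.graph.neg_mem (A.adjoint.mem_graph x.1)
  refine LinearMap.rank_le_of_injective (f.codRestrict _ hf) fun x y hxy => ?_
  have hxy' : f x = f y := congrArg Subtype.val hxy
  have : -(x.1 : H) = -(y.1 : H) := by
    rw [← hval x, ← hval y]
    exact congrArg B.adjoint hxy'
  exact Subtype.ext (Subtype.ext (neg_injective this))

lemma scodim_adjoint_domain {A B : H →ₗ.[ℂ] H} (hB : Dense (B.domain : Set H))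
    (hBcl : B.IsClosed) (hBA : B ≤ A.adjoint) :
    scodim B.domain A.adjoint.domain = Module.rank ℂ (kerAdjointMulAdjointAddOne A B) :=
  (Submodule.quotientEquivOfIsCompl _ _ ⟨disjoint_kerAdjointMulAdjointAddOne hB hBA,
    codisjoint_kerAdjointMulAdjointAddOne hB hBcl hBA⟩).rank_eq

end LinearPMap

/-- For a dual pair `{A, B}` of densely defined closed operators,
`n(A*, B) := dim (dom A* / dom B)` equals `n(B*, A) := dim (dom B* / dom A)`. -/
theorem statement1 (A B : H →ₗ.[ℂ] H)
    (hA : Dense (A.domain : Set H)) (hB : Dense (B.domain : Set H))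
    (hAcl : A.IsClosed) (hBcl : B.IsClosed)
    (hAB : A ≤ B.adjoint) (hBA : B ≤ A.adjoint) :
    scodim B.domain A.adjoint.domain = scodim A.domain B.adjoint.domain := by
  rw [LinearPMap.scodim_adjoint_domain hB hBcl hBA, LinearPMap.scodim_adjoint_domain hA hAcl hAB]
  exact le_antisymm (LinearPMap.rank_kerAdjointMulAdjointAddOne_le A B)
    (LinearPMap.rank_kerAdjointMulAdjointAddOne_le B A)

end
end

section
/- Let H be a complex Hilbert space, {A,B} a dual pair of densely defined closed operators on H, and à ∈ Ext{A,B} a proper extension with nonempty resolvent set. Then for any λ₀ ∈ ρ(Ã) the following direct (not necessarily orthogonal) sum decompositions hold: dom à = dom A ∔ (à − λ₀)⁻¹ N_{λ̄₀}(A) and dom Ã* = dom B ∔ (Ã* − λ̄₀)⁻¹ N_{λ₀}(B), where N_{λ̄₀}(A) = ker(A* − λ̄₀) and N_{λ₀}(B) = ker(B* − λ₀). -/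
noncomputable section

variable {H : Type*} [NormedAddCommGroup H] [InnerProductSpace ℂ H] [CompleteSpace H]

namespace LinearPMap

/-- The range `ran (A - l)`, for `A` contained in an operator with resolvent `R` at `l`. -/
def resolventRange (A : H →ₗ.[ℂ] H) (l : ℂ) (R : H →L[ℂ] H) : Submodule ℂ H :=
  A.graph.comap (R.prod (ContinuousLinearMap.id ℂ H + l • R) : H →L[ℂ] H × H).toLinearMap

theorem mem_resolventRange {E : Type*} [NormedAddCommGroup E] [InnerProductSpace ℂ E]
    {A : E →ₗ.[ℂ] E} {l : ℂ} {R : E →L[ℂ] E} {y : E} :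
    y ∈ A.resolventRange l R ↔ ∃ h : R y ∈ A.domain, A ⟨R y, h⟩ = y + l • R y := by
  simp [resolventRange, LinearPMap.mem_graph_iff]

theorem IsClosed.isClosed_resolventRange {E : Type*} [NormedAddCommGroup E] [InnerProductSpace ℂ E]
    {A : E →ₗ.[ℂ] E} (hA : A.IsClosed) (l : ℂ)
    (R : E →L[ℂ] E) : _root_.IsClosed (A.resolventRange l R : Set E) :=
  _root_.IsClosed.preimage
    (R.prod (ContinuousLinearMap.id ℂ E + l • R) : E →L[ℂ] E × E).continuous hA

theorem sub_smul_mem_resolventRange {E : Type*} [NormedAddCommGroup E] [InnerProductSpace ℂ E]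
    {A T : E →ₗ.[ℂ] E} (hAT : A ≤ T) {l : ℂ} {R : E →L[ℂ] E}
    (hRleft : ∀ x : T.domain, R (T x - l • (x : E)) = x) (x : A.domain) :
    A x - l • (x : E) ∈ A.resolventRange l R := by
  have hx : R (A x - l • (x : E)) = x := by
    rw [hAT.2 (x := x) (y := ⟨x, hAT.1 x.2⟩) rfl]
    exact hRleft ⟨x, hAT.1 x.2⟩
  refine mem_resolventRange.2 ⟨by rw [hx]; exact x.2, ?_⟩
  simp only [hx, sub_add_cancel]

theorem inner_sub_smul_eq_zero_of_mem_eigSpace {A : H →ₗ.[ℂ] H} (hA : Dense (A.domain : Set H))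
    {l : ℂ} {u : H} (hu : u ∈ A.adjoint.eigSpace ((starRingEnd ℂ) l)) (x : A.domain) :
    inner ℂ u (A x - l • (x : H)) = 0 := by
  obtain ⟨hu, e⟩ := hu
  have h := adjoint_isFormalAdjoint hA ⟨u, hu⟩ x
  rw [e, inner_smul_left, Complex.conj_conj] at h
  rw [inner_sub_right, inner_smul_right, h, sub_self]

theorem mem_eigSpace_adjoint {A : H →ₗ.[ℂ] H} (hA : Dense (A.domain : Set H))
    {l : ℂ} {u : H} (hu : ∀ x : A.domain, inner ℂ u (A x - l • (x : H)) = 0) :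
    u ∈ A.adjoint.eigSpace ((starRingEnd ℂ) l) := by
  have key (x : A.domain) : inner ℂ ((starRingEnd ℂ) l • u) (x : H) = inner ℂ u (A x) := by
    have h := hu x
    rw [inner_sub_right, inner_smul_right, sub_eq_zero] at h
    rw [inner_smul_left, Complex.conj_conj, h]
  exact ⟨mem_adjoint_domain_of_exists _ ⟨_, key⟩, adjoint_apply_eq hA _ key⟩

/-- If `T` extends the closed operator `A` and `R = (T - l)⁻¹`, then `dom T` is the sum of `dom A`
and the image under `R` of the defect subspace of `A` at `conj l`. -/
theorem exists_eq_add_resolvent {A T : H →ₗ.[ℂ] H} (hA : Dense (A.domain : Set H))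
    (hAcl : A.IsClosed) (hAT : A ≤ T) {l : ℂ} {R : H →L[ℂ] H}
    (hRleft : ∀ x : T.domain, R (T x - l • (x : H)) = x) {g : H} (hg : g ∈ T.domain) :
    ∃ f ∈ A.domain, ∃ u ∈ A.adjoint.eigSpace ((starRingEnd ℂ) l), g = f + R u := by
  have : CompleteSpace (A.resolventRange l R) :=
    (hAcl.isClosed_resolventRange l R).completeSpace_coe
  obtain ⟨m, hm, u, hu, e⟩ :=
    (A.resolventRange l R).exists_add_mem_mem_orthogonal (T ⟨g, hg⟩ - l • g)
  refine ⟨R m, (mem_resolventRange.1 hm).1, u, mem_eigSpace_adjoint hA fun x => ?_, ?_⟩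
  · exact Submodule.inner_left_of_mem_orthogonal (sub_smul_mem_resolventRange hAT hRleft x) hu
  · rw [← R.map_add, ← e]
    exact (hRleft ⟨g, hg⟩).symm

/-- The sum of `dom A` and of the image of the defect subspace under `(T - l)⁻¹` is direct. -/
theorem eq_and_eq_of_add_resolvent_eq {A T : H →ₗ.[ℂ] H} (hA : Dense (A.domain : Set H))
    (hAT : A ≤ T) {l : ℂ} {R : H →L[ℂ] H} (hRinj : Function.Injective R)
    (hRleft : ∀ x : T.domain, R (T x - l • (x : H)) = x)
    {f₁ u₁ f₂ u₂ : H} (hf₁ : f₁ ∈ A.domain)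
    (hu₁ : u₁ ∈ A.adjoint.eigSpace ((starRingEnd ℂ) l)) (hf₂ : f₂ ∈ A.domain)
    (hu₂ : u₂ ∈ A.adjoint.eigSpace ((starRingEnd ℂ) l)) (h : f₁ + R u₁ = f₂ + R u₂) :
    f₁ = f₂ ∧ u₁ = u₂ := by
  have hx : f₁ - f₂ = R (u₂ - u₁) := by
    rw [R.map_sub, sub_eq_sub_iff_add_eq_add, h, add_comm]
  let x : A.domain := ⟨f₁ - f₂, A.domain.sub_mem hf₁ hf₂⟩
  have e : A x - l • (x : H) = u₂ - u₁ := by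
    apply hRinj
    rw [← hx, hAT.2 (x := x) (y := ⟨x, hAT.1 x.2⟩) rfl]
    exact hRleft ⟨x, hAT.1 x.2⟩
  have h0 := inner_sub_smul_eq_zero_of_mem_eigSpace hA (Submodule.sub_mem _ hu₂ hu₁) x
  rw [e, inner_self_eq_zero, sub_eq_zero] at h0
  subst h0
  exact ⟨add_right_cancel h, rfl⟩

theorem le_adjoint_of_le_adjoint {S T : H →ₗ.[ℂ] H} (hS : Dense (S.domain : Set H))
    (hT : Dense (T.domain : Set H)) (h : T ≤ S.adjoint) : S ≤ T.adjoint := by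
  refine IsFormalAdjoint.le_adjoint hT fun x y => ?_
  rw [h.2 (x := x) (y := ⟨x, h.1 x.2⟩) rfl]
  exact adjoint_isFormalAdjoint hS ⟨x, h.1 x.2⟩ y

theorem adjoint_resolvent_left {T : H →ₗ.[ℂ] H} (hT : Dense (T.domain : Set H)) {l : ℂ}
    {R : H →L[ℂ] H} (hR : ∀ y : H, R y ∈ T.domain)
    (hRright : ∀ y : H, T ⟨R y, hR y⟩ - l • R y = y) (x : T.adjoint.domain) :
    ContinuousLinearMap.adjoint R (T.adjoint x - (starRingEnd ℂ) l • (x : H)) = x := by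
  refine ext_inner_right ℂ fun y => ?_
  have h := adjoint_isFormalAdjoint hT x ⟨R y, hR y⟩
  rw [ContinuousLinearMap.adjoint_inner_left, inner_sub_left, inner_smul_left,
    Complex.conj_conj, h, ← inner_smul_right, ← inner_sub_right, hRright]

theorem injective_adjoint_resolvent {T : H →ₗ.[ℂ] H} {l : ℂ} {R : H →L[ℂ] H}
    (hT : Dense (T.domain : Set H)) (hRleft : ∀ x : T.domain, R (T x - l • (x : H)) = x) :
    Function.Injective (ContinuousLinearMap.adjoint R) := by
  intro y z h
  refine hT.eq_of_inner_left ℂ fun v hv => ?_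
  rw [← show R (T ⟨v, hv⟩ - l • v) = v from hRleft ⟨v, hv⟩, ← ContinuousLinearMap.adjoint_inner_left, h,
    ContinuousLinearMap.adjoint_inner_left]

end LinearPMap

/-- For a proper extension `Ã` of a dual pair `{A,B}` and `λ₀ ∈ ρ(Ã)` with resolvent
`R = (Ã - λ₀)⁻¹`, the direct sum decompositions
`dom Ã = dom A ∔ (Ã - λ₀)⁻¹ N_{λ̄₀}(A)` and
`dom Ã* = dom B ∔ (Ã* - λ̄₀)⁻¹ N_{λ₀}(B)` hold, where `N_λ(T) = ker(T* - λ)`. -/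
theorem statement5 (A B At : H →ₗ.[ℂ] H)
    (hA : Dense (A.domain : Set H)) (hB : Dense (B.domain : Set H))
    (hAcl : A.IsClosed) (hBcl : B.IsClosed)
    (hAB : A ≤ B.adjoint) (hBA : B ≤ A.adjoint)
    (hext1 : A ≤ At) (hext2 : At ≤ B.adjoint)
    (l : ℂ) (R : H →L[ℂ] H) (hR : ∀ y : H, R y ∈ At.domain)
    (hRleft : ∀ x : At.domain, R (At x - l • (x : H)) = x)
    (hRright : ∀ y : H, At ⟨R y, hR y⟩ - l • R y = y) :
    -- `dom Ã = dom A ∔ R (N_{λ̄₀}(A))` :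
    ((∀ g, g ∈ At.domain →
        ∃ f ∈ A.domain, ∃ u ∈ A.adjoint.eigSpace ((starRingEnd ℂ) l), g = f + R u) ∧
      (∀ f₁ ∈ A.domain, ∀ u₁ ∈ A.adjoint.eigSpace ((starRingEnd ℂ) l),
        ∀ f₂ ∈ A.domain, ∀ u₂ ∈ A.adjoint.eigSpace ((starRingEnd ℂ) l),
          f₁ + R u₁ = f₂ + R u₂ → f₁ = f₂ ∧ u₁ = u₂)) ∧
    -- `dom Ã* = dom B ∔ R* (N_{λ₀}(B))` :
    ((∀ g, g ∈ At.adjoint.domain →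
        ∃ f ∈ B.domain, ∃ u ∈ B.adjoint.eigSpace l,
          g = f + ContinuousLinearMap.adjoint R u) ∧
      (∀ f₁ ∈ B.domain, ∀ u₁ ∈ B.adjoint.eigSpace l,
        ∀ f₂ ∈ B.domain, ∀ u₂ ∈ B.adjoint.eigSpace l,
          f₁ + ContinuousLinearMap.adjoint R u₁ = f₂ + ContinuousLinearMap.adjoint R u₂ →
            f₁ = f₂ ∧ u₁ = u₂)) := by
  have hAt : Dense (At.domain : Set H) := hA.mono hext1.1
  have hBAt : B ≤ At.adjoint := LinearPMap.le_adjoint_of_le_adjoint hB hAt hext2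
  have hRinj : Function.Injective R := by
    intro y z h
    rw [← hRright y, ← hRright z]
    simp only [h]
  have hRadj := LinearPMap.adjoint_resolvent_left hAt hR hRright
  have hRadjinj := LinearPMap.injective_adjoint_resolvent hAt hRleft
  refine ⟨⟨fun g hg => LinearPMap.exists_eq_add_resolvent hA hAcl hext1 hRleft hg,
    fun f₁ hf₁ u₁ hu₁ f₂ hf₂ u₂ hu₂ h =>
      LinearPMap.eq_and_eq_of_add_resolvent_eq hA hext1 hRinj hRleft hf₁ hu₁ hf₂ hu₂ h⟩, ?_⟩
  rw [← Complex.conj_conj l]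
  exact ⟨fun g hg => LinearPMap.exists_eq_add_resolvent hB hBcl hBAt hRadj hg,
    fun f₁ hf₁ u₁ hu₁ f₂ hf₂ u₂ hu₂ h =>
      LinearPMap.eq_and_eq_of_add_resolvent_eq hB hBAt hRadjinj hRadj hf₁ hu₁ hf₂ hu₂ h⟩

end
end

section
/- Let H be a complex Hilbert space, {A,B} a dual pair of densely defined closed operators on H, λ₀ ∈ ρ̂{A,B}, and à ∈ Ext{A,B} a proper extension with λ₀ ∈ ρ(Ã). Then the following direct sum decompositions hold: dom B* = dom A ∔ (à − λ₀)⁻¹ N_{λ̄₀}(A) ∔ N_{λ₀}(B) and dom A* = dom B ∔ (Ã* − λ̄₀)⁻¹ N_{λ₀}(B) ∔ N_{λ̄₀}(A), where N_{λ̄₀}(A) = ker(A* − λ̄₀) and N_{λ₀}(B) = ker(B* − λ₀). -/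
noncomputable section

variable {H : Type*} [NormedAddCommGroup H] [InnerProductSpace ℂ H] [CompleteSpace H]

/-- `l` belongs to the field of regularity of `T` if `‖(T - l) f‖ ≥ ε ‖f‖` on `dom T`
for some `ε > 0`. -/
def LinearPMap.InFieldOfRegularity (T : H →ₗ.[ℂ] H) (l : ℂ) : Prop :=
  ∃ ε : ℝ, 0 < ε ∧ ∀ x : T.domain, ε * ‖(x : H)‖ ≤ ‖T x - l • (x : H)‖

/-- The defect subspace `ker (T* - c)` is the orthogonal complement of the range of `T - c̄`. -/
theorem LinearPMap.mem_eigSpace_adjoint_iff {T : H →ₗ.[ℂ] H} (hT : Dense (T.domain : Set H))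
    {c : ℂ} {x : H} :
    x ∈ T.adjoint.eigSpace c ↔
      ∀ y : T.domain, inner ℂ x (T y - (starRingEnd ℂ) c • (y : H)) = 0 := by
  constructor
  · rintro ⟨hx, ex⟩ y
    have h := LinearPMap.adjoint_isFormalAdjoint hT ⟨x, hx⟩ y
    rw [ex, inner_smul_left] at h
    rw [inner_sub_right, inner_smul_right, ← h, sub_self]
  · intro h
    have key : ∀ y : T.domain, inner ℂ (c • x) (y : H) = inner ℂ x (T y) := by
      intro y
      have hy := h y
      rw [inner_sub_right, inner_smul_right, sub_eq_zero] at hy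
      rw [inner_smul_left, hy]
    have hx : x ∈ T.adjoint.domain := LinearPMap.mem_adjoint_domain_of_exists x ⟨_, key⟩
    exact ⟨hx, LinearPMap.adjoint_apply_eq hT ⟨x, hx⟩ key⟩

/-- If `T` is closed and `R` is a bounded left inverse of `T - l`, then the range of `T - l` has an
orthogonal decomposition: every `w` is the sum of some `(T - l) f` and an element of the defect
subspace. -/
theorem LinearPMap.exists_range_add_eigSpace {T : H →ₗ.[ℂ] H} (hT : Dense (T.domain : Set H))
    (hcl : T.IsClosed) (l : ℂ) (R : H →L[ℂ] H)
    (hR : ∀ x : T.domain, R (T x - l • (x : H)) = x) (w : H) :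
    ∃ f : T.domain, ∃ u ∈ T.adjoint.eigSpace ((starRingEnd ℂ) l),
      w = (T f - l • (f : H)) + u := by
  let Φ : H →L[ℂ] H × H := R.prod (ContinuousLinearMap.id ℂ H + l • R)
  let M : Submodule ℂ H := T.graph.comap (Φ : H →ₗ[ℂ] H × H)
  have hM : _root_.IsClosed (M : Set H) := _root_.IsClosed.preimage Φ.continuous hcl
  have : CompleteSpace M := hM.completeSpace_coe
  have mem_M : ∀ x : T.domain, T x - l • (x : H) ∈ M := by
    intro x
    change (R (T x - l • (x : H)), (T x - l • (x : H)) + l • R (T x - l • (x : H))) ∈ T.graph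
    rw [hR, sub_add_cancel]
    exact T.mem_graph x
  obtain ⟨m, hm, u, hu, rfl⟩ := M.exists_add_mem_mem_orthogonal w
  obtain ⟨f, hf, hTf⟩ := (LinearPMap.mem_graph_iff T).1 hm
  change (f : H) = R m at hf
  change T f = m + l • R m at hTf
  refine ⟨f, u, (LinearPMap.mem_eigSpace_adjoint_iff hT).2 fun y => ?_, ?_⟩
  · rw [Complex.conj_conj]
    exact Submodule.inner_left_of_mem_orthogonal (mem_M y) hu
  · rw [hf, hTf, add_sub_cancel_right]

/-- The decomposition `dom B* = dom A ∔ R ker (A* - l̄) ∔ ker (B* - l)` when `A` is closed, `R` is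
a bounded left inverse of `A - l` and `R*` is a left inverse of `B - l̄`. -/
theorem LinearPMap.adjoint_domain_decomposition (A B : H →ₗ.[ℂ] H)
    (hA : Dense (A.domain : Set H)) (hB : Dense (B.domain : Set H)) (hAcl : A.IsClosed)
    (l : ℂ) (R : H →L[ℂ] H) (hRA : ∀ x : A.domain, R (A x - l • (x : H)) = x)
    (hRB : ∀ x : B.domain,
      ContinuousLinearMap.adjoint R (B x - (starRingEnd ℂ) l • (x : H)) = x) :
    (∀ g, g ∈ B.adjoint.domain →
        ∃ f ∈ A.domain, ∃ u ∈ A.adjoint.eigSpace ((starRingEnd ℂ) l),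
          ∃ v ∈ B.adjoint.eigSpace l, g = f + R u + v) ∧
      (∀ f₁ ∈ A.domain, ∀ u₁ ∈ A.adjoint.eigSpace ((starRingEnd ℂ) l),
        ∀ v₁ ∈ B.adjoint.eigSpace l,
        ∀ f₂ ∈ A.domain, ∀ u₂ ∈ A.adjoint.eigSpace ((starRingEnd ℂ) l),
        ∀ v₂ ∈ B.adjoint.eigSpace l,
          f₁ + R u₁ + v₁ = f₂ + R u₂ + v₂ → f₁ = f₂ ∧ u₁ = u₂ ∧ v₁ = v₂) := by
  have inner_R : ∀ (y : H) (z : B.domain),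
      inner ℂ (R y) (B z - (starRingEnd ℂ) l • (z : H)) = inner ℂ y (z : H) := by
    intro y z
    rw [← ContinuousLinearMap.adjoint_inner_right, hRB]
  constructor
  · intro g hg
    obtain ⟨f, u, hu, hw⟩ := LinearPMap.exists_range_add_eigSpace hA hAcl l R hRA
      (B.adjoint ⟨g, hg⟩ - l • g)
    refine ⟨f, f.2, u, hu, g - R (B.adjoint ⟨g, hg⟩ - l • g),
      (LinearPMap.mem_eigSpace_adjoint_iff hB).2 fun z => ?_, ?_⟩
    · have h := LinearPMap.adjoint_isFormalAdjoint hB ⟨g, hg⟩ z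
      rw [inner_sub_left, inner_R, inner_sub_left, h, inner_sub_right, inner_smul_left,
        inner_smul_right, sub_self]
    · rw [hw, R.map_add, hRA, add_sub_cancel]
  · have indep : ∀ f ∈ A.domain, ∀ u ∈ A.adjoint.eigSpace ((starRingEnd ℂ) l),
        ∀ v ∈ B.adjoint.eigSpace l, f + R u + v = 0 → f = 0 ∧ u = 0 ∧ v = 0 := by
      intro f hf u hu v hv h
      have hsum : A ⟨f, hf⟩ - l • f + u = 0 := by
        refine hB.eq_zero_of_inner_left ℂ fun z hz => ?_
        have hv' := (LinearPMap.mem_eigSpace_adjoint_iff hB).1 hv ⟨z, hz⟩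
        have hfR := hRA ⟨f, hf⟩
        rw [← inner_R _ ⟨z, hz⟩, R.map_add, hfR, eq_neg_of_add_eq_zero_left h, inner_neg_left, hv',
          neg_zero]
      have hu' := (LinearPMap.mem_eigSpace_adjoint_iff hA).1 hu ⟨f, hf⟩
      rw [Complex.conj_conj, eq_neg_of_add_eq_zero_left hsum, inner_neg_right, neg_eq_zero,
        inner_self_eq_zero] at hu'
      subst hu'
      have hf0 : f = 0 := by
        have hfR := hRA ⟨f, hf⟩
        rw [add_zero] at hsum
        rw [hsum, R.map_zero] at hfR
        exact hfR.symm
      subst hf0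
      simpa using h
    intro f₁ hf₁ u₁ hu₁ v₁ hv₁ f₂ hf₂ u₂ hu₂ v₂ hv₂ h
    have h0 : (f₁ - f₂) + R (u₁ - u₂) + (v₁ - v₂) = 0 := by
      rw [R.map_sub, ← sub_eq_zero.2 h]
      abel
    simpa only [sub_eq_zero] using indep _ (sub_mem hf₁ hf₂) _ (sub_mem hu₁ hu₂) _
      (sub_mem hv₁ hv₂) h0

/-- For a dual pair `{A,B}`, `λ₀ ∈ ρ̂{A,B}`, and a proper extension `Ã` with `λ₀ ∈ ρ(Ã)`
(with resolvent `R = (Ã - λ₀)⁻¹`), the direct sum decompositions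
`dom B* = dom A ∔ (Ã - λ₀)⁻¹ N_{λ̄₀}(A) ∔ N_{λ₀}(B)` and
`dom A* = dom B ∔ (Ã* - λ̄₀)⁻¹ N_{λ₀}(B) ∔ N_{λ̄₀}(A)` hold. -/
theorem statement6 (A B At : H →ₗ.[ℂ] H)
    (hA : Dense (A.domain : Set H)) (hB : Dense (B.domain : Set H))
    (hAcl : A.IsClosed) (hBcl : B.IsClosed)
    (hAB : A ≤ B.adjoint) (hBA : B ≤ A.adjoint)
    (l : ℂ) (hlA : A.InFieldOfRegularity l)
    (hlB : B.InFieldOfRegularity ((starRingEnd ℂ) l))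
    (hext1 : A ≤ At) (hext2 : At ≤ B.adjoint)
    (R : H →L[ℂ] H) (hR : ∀ y : H, R y ∈ At.domain)
    (hRleft : ∀ x : At.domain, R (At x - l • (x : H)) = x)
    (hRright : ∀ y : H, At ⟨R y, hR y⟩ - l • R y = y) :
    -- `dom B* = dom A ∔ R N_{λ̄₀}(A) ∔ N_{λ₀}(B)` :
    ((∀ g, g ∈ B.adjoint.domain →
        ∃ f ∈ A.domain, ∃ u ∈ A.adjoint.eigSpace ((starRingEnd ℂ) l),
          ∃ v ∈ B.adjoint.eigSpace l, g = f + R u + v) ∧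
      (∀ f₁ ∈ A.domain, ∀ u₁ ∈ A.adjoint.eigSpace ((starRingEnd ℂ) l),
        ∀ v₁ ∈ B.adjoint.eigSpace l,
        ∀ f₂ ∈ A.domain, ∀ u₂ ∈ A.adjoint.eigSpace ((starRingEnd ℂ) l),
        ∀ v₂ ∈ B.adjoint.eigSpace l,
          f₁ + R u₁ + v₁ = f₂ + R u₂ + v₂ → f₁ = f₂ ∧ u₁ = u₂ ∧ v₁ = v₂)) ∧
    -- `dom A* = dom B ∔ R* N_{λ₀}(B) ∔ N_{λ̄₀}(A)` :
    ((∀ g, g ∈ A.adjoint.domain →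
        ∃ f ∈ B.domain, ∃ u ∈ B.adjoint.eigSpace l,
          ∃ v ∈ A.adjoint.eigSpace ((starRingEnd ℂ) l),
            g = f + ContinuousLinearMap.adjoint R u + v) ∧
      (∀ f₁ ∈ B.domain, ∀ u₁ ∈ B.adjoint.eigSpace l,
        ∀ v₁ ∈ A.adjoint.eigSpace ((starRingEnd ℂ) l),
        ∀ f₂ ∈ B.domain, ∀ u₂ ∈ B.adjoint.eigSpace l,
        ∀ v₂ ∈ A.adjoint.eigSpace ((starRingEnd ℂ) l),
          f₁ + ContinuousLinearMap.adjoint R u₁ + v₁ =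
              f₂ + ContinuousLinearMap.adjoint R u₂ + v₂ →
            f₁ = f₂ ∧ u₁ = u₂ ∧ v₁ = v₂)) := by
  have hRA : ∀ x : A.domain, R (A x - l • (x : H)) = x := by
    intro x
    have hx := hRleft ⟨x, hext1.1 x.2⟩
    rwa [← hext1.2 (x := x) (y := ⟨x, hext1.1 x.2⟩) rfl] at hx
  have hRB : ∀ x : B.domain,
      ContinuousLinearMap.adjoint R (B x - (starRingEnd ℂ) l • (x : H)) = x := by
    intro x
    refine ext_inner_left ℂ fun y => ?_
    have h := LinearPMap.adjoint_isFormalAdjoint hB ⟨R y, hext2.1 (hR y)⟩ x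
    rw [← hext2.2 (x := ⟨R y, hR y⟩) (y := ⟨R y, hext2.1 (hR y)⟩) rfl] at h
    rw [ContinuousLinearMap.adjoint_inner_right, inner_sub_right, ← h, inner_smul_right,
      ← inner_smul_left, ← inner_sub_left, hRright]
  refine ⟨LinearPMap.adjoint_domain_decomposition A B hA hB hAcl l R hRA hRB, ?_⟩
  have key := LinearPMap.adjoint_domain_decomposition B A hB hA hBcl ((starRingEnd ℂ) l)
    (ContinuousLinearMap.adjoint R) hRB
    (by simpa only [Complex.conj_conj, ContinuousLinearMap.adjoint_adjoint] using hRA)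
  rwa [Complex.conj_conj] at key

end
end
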